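/- arXiv:math/9808031 — 3 statements merged into one kernel-verified Lean document; each statement's English description precedes it below -/
import Mathlib

section
/- Let 0 < q < 1 and r₀ > 0. On the complex vector space V of finitely supported functions ℤ → ℂ with standard basis (e_j)_{j∈ℤ} and the ℓ² inner product, define ℂ-linear operators Z₊e_j = r₀·q^{−j+1/2}·e_{j−1}, Z₋e_j = r₀·q^{−j−1/2}·e_{j+1}, N e_j = e_{j−2}, N⁻¹e_j = e_{j+2}. Then these operators satisfy the E_q(2) relations Z₊Z₋ = q⁻²·Z₋Z₊, Z₊N = q²·N Z₊, Z₋N = q²·N Z₋, N∘N⁻¹ = N⁻¹∘N = id, and the involution relations ⟨Z₊f, g⟩ = ⟨f, Z₋g⟩ and ⟨N f, g⟩ = ⟨f, N⁻¹g⟩ for all f, g ∈ V. -/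
open Finsupp

/-- The ℓ² inner product on finitely supported functions `ℤ → ℂ`:
`⟨f, g⟩ = Σ_j conj (f j) * g j`. -/
noncomputable def ellTwoInner (f g : ℤ →₀ ℂ) : ℂ :=
  f.sum fun j c => (starRingEnd ℂ) c * g j

theorem ellTwoInner_add_left (f f' g : ℤ →₀ ℂ) :
    ellTwoInner (f + f') g = ellTwoInner f g + ellTwoInner f' g :=
  Finsupp.sum_add_index' (by simp) (by intros; simp [add_mul])

theorem ellTwoInner_smul_left (c : ℂ) (f g : ℤ →₀ ℂ) :
    ellTwoInner (c • f) g = (starRingEnd ℂ) c * ellTwoInner f g := by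
  unfold ellTwoInner
  rw [Finsupp.sum_smul_index' (by simp), Finsupp.mul_sum]
  simp [mul_assoc]

theorem ellTwoInner_add_right (f g g' : ℤ →₀ ℂ) :
    ellTwoInner f (g + g') = ellTwoInner f g + ellTwoInner f g' := by
  simp [ellTwoInner, mul_add, Finsupp.sum_add]

theorem ellTwoInner_smul_right (c : ℂ) (f g : ℤ →₀ ℂ) :
    ellTwoInner f (c • g) = c * ellTwoInner f g := by
  simp [ellTwoInner, Finsupp.mul_sum, mul_left_comm]

theorem ellTwoInner_single_one (j k : ℤ) :
    ellTwoInner (Finsupp.single j 1) (Finsupp.single k 1) = if k = j then 1 else 0 := by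
  simp [ellTwoInner, Finsupp.single_apply, eq_comm]

theorem ellTwoInner_zero_left (g : ℤ →₀ ℂ) : ellTwoInner 0 g = 0 :=
  Finsupp.sum_zero_index

theorem ellTwoInner_zero_right (f : ℤ →₀ ℂ) : ellTwoInner f 0 = 0 := by
  simp [ellTwoInner]

/-- Two linear operators are adjoint as soon as they are adjoint on the standard basis. -/
theorem ellTwoInner_adjoint_of_single (A B : (ℤ →₀ ℂ) →ₗ[ℂ] (ℤ →₀ ℂ))
    (h : ∀ j k : ℤ, ellTwoInner (A (Finsupp.single j 1)) (Finsupp.single k 1) =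
      ellTwoInner (Finsupp.single j 1) (B (Finsupp.single k 1))) (f g : ℤ →₀ ℂ) :
    ellTwoInner (A f) g = ellTwoInner f (B g) := by
  induction f using Finsupp.induction_linear with
  | zero => simp [ellTwoInner_zero_left]
  | add f f' hf hf' => simp only [map_add, ellTwoInner_add_left, hf, hf']
  | single j a =>
    induction g using Finsupp.induction_linear with
    | zero => simp [ellTwoInner_zero_right]
    | add g g' hg hg' => simp only [map_add, ellTwoInner_add_right, hg, hg']
    | single k b =>
      rw [← Finsupp.smul_single_one j a, ← Finsupp.smul_single_one k b]
      simp only [map_smul, ellTwoInner_smul_left, ellTwoInner_smul_right, h]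

/-- Linear operators on finitely supported functions agree if they agree on the standard basis. -/
theorem linearMap_ext_single_one {A B : (ℤ →₀ ℂ) →ₗ[ℂ] (ℤ →₀ ℂ)}
    (h : ∀ j : ℤ, A (Finsupp.single j 1) = B (Finsupp.single j 1)) : A = B :=
  Finsupp.lhom_ext' fun j => LinearMap.ext_ring (h j)

/-- The operators `Z₊ e_j = r₀ q^{−j+1/2} e_{j−1}`, `Z₋ e_j = r₀ q^{−j−1/2} e_{j+1}`,
`N e_j = e_{j−2}`, `N⁻¹ e_j = e_{j+2}` on the space of finitely supported functions `ℤ → ℂ`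
satisfy the `E_q(2)` relations `Z₊Z₋ = q⁻² Z₋Z₊`, `Z₊N = q² N Z₊`, `Z₋N = q² N Z₋`,
`N N⁻¹ = N⁻¹ N = id`, and the involution relations `⟨Z₊ f, g⟩ = ⟨f, Z₋ g⟩`,
`⟨N f, g⟩ = ⟨f, N⁻¹ g⟩`. -/
theorem Eq2_realization_on_circle
    (q r₀ : ℝ) (hq0 : 0 < q) (hq1 : q < 1) (hr₀ : 0 < r₀)
    (Zp Zm N Ninv : (ℤ →₀ ℂ) →ₗ[ℂ] (ℤ →₀ ℂ))
    (hZp : ∀ j : ℤ, Zp (Finsupp.single j 1) =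
      ((r₀ * Real.rpow q (-(j : ℝ) + 1 / 2) : ℝ) : ℂ) • Finsupp.single (j - 1) (1 : ℂ))
    (hZm : ∀ j : ℤ, Zm (Finsupp.single j 1) =
      ((r₀ * Real.rpow q (-(j : ℝ) - 1 / 2) : ℝ) : ℂ) • Finsupp.single (j + 1) (1 : ℂ))
    (hN : ∀ j : ℤ, N (Finsupp.single j 1) = Finsupp.single (j - 2) (1 : ℂ))
    (hNinv : ∀ j : ℤ, Ninv (Finsupp.single j 1) = Finsupp.single (j + 2) (1 : ℂ)) :
    Zp ∘ₗ Zm = (((q : ℂ) ^ 2)⁻¹) • (Zm ∘ₗ Zp) ∧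
    Zp ∘ₗ N = ((q : ℂ) ^ 2) • (N ∘ₗ Zp) ∧
    Zm ∘ₗ N = ((q : ℂ) ^ 2) • (N ∘ₗ Zm) ∧
    N ∘ₗ Ninv = LinearMap.id ∧
    Ninv ∘ₗ N = LinearMap.id ∧
    (∀ f g : ℤ →₀ ℂ, ellTwoInner (Zp f) g = ellTwoInner f (Zm g)) ∧
    (∀ f g : ℤ →₀ ℂ, ellTwoInner (N f) g = ellTwoInner f (Ninv g)) := by
  have hshift (x y : ℝ) (h : y = x + 2) : q ^ y = q ^ 2 * q ^ x := by
    rw [h, Real.rpow_add hq0, Real.rpow_two, mul_comm]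
  have hqC : (q : ℂ) ≠ 0 := by exact_mod_cast hq0.ne'
  simp only [Real.rpow_eq_pow] at hZp hZm
  refine ⟨linearMap_ext_single_one fun j => ?_, linearMap_ext_single_one fun j => ?_,
    linearMap_ext_single_one fun j => ?_, linearMap_ext_single_one fun j => ?_,
    linearMap_ext_single_one fun j => ?_, ellTwoInner_adjoint_of_single _ _ fun j k => ?_,
    ellTwoInner_adjoint_of_single _ _ fun j k => ?_⟩
  · simp only [LinearMap.comp_apply, LinearMap.smul_apply, hZp, hZm, map_smul, smul_smul,
      add_sub_cancel_right, sub_add_cancel]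
    congr 1
    rw [show -((j - 1 : ℤ) : ℝ) - 1 / 2 = -(j : ℝ) + 1 / 2 by push_cast; ring,
      show -((j + 1 : ℤ) : ℝ) + 1 / 2 = -(j : ℝ) - 1 / 2 by push_cast; ring,
      eq_inv_mul_iff_mul_eq₀ (pow_ne_zero 2 hqC)]
    have hx : q ^ (-(j : ℝ) + 1 / 2) = q * q ^ (-(j : ℝ) - 1 / 2) := by
      rw [show -(j : ℝ) + 1 / 2 = 1 + (-(j : ℝ) - 1 / 2) by ring, Real.rpow_add hq0,
        Real.rpow_one]
    rw [hx]
    push_cast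
    ring
  · simp only [LinearMap.comp_apply, LinearMap.smul_apply, hZp, hN, map_smul, smul_smul]
    rw [hshift (-(j : ℝ) + 1 / 2) _ (by push_cast; ring), sub_right_comm]
    congr 1
    push_cast
    ring
  · simp only [LinearMap.comp_apply, LinearMap.smul_apply, hZm, hN, map_smul, smul_smul]
    rw [hshift (-(j : ℝ) - 1 / 2) _ (by push_cast; ring), sub_add_eq_add_sub]
    congr 1
    push_cast
    ring
  · simp [hN, hNinv]
  · simp [hN, hNinv]
  · rw [hZp, hZm, ellTwoInner_smul_left, ellTwoInner_smul_right, ellTwoInner_single_one,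
      ellTwoInner_single_one, Complex.conj_ofReal]
    by_cases h : k = j - 1
    · subst h
      rw [show -((j - 1 : ℤ) : ℝ) - 1 / 2 = -(j : ℝ) + 1 / 2 by push_cast; ring]
      simp
    · rw [if_neg h, if_neg (by lia), mul_zero, mul_zero]
  · rw [hN, hNinv, ellTwoInner_single_one, ellTwoInner_single_one]
    exact if_congr (by lia) rfl rfl
end

section
/- The Cartesian momentum operators on the quantum-plane monomial module satisfy the commutation relation [P_x, P_y] = −i·tanh(Λ)·(P_x² + P_y²) as linear operators on V. -/
noncomputable section

/-- The quantum-plane monomial module: finitely supported functions `ℕ × ℕ → ℂ`,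
with basis vector `e(n,m)` thought of as the monomial `z₊ⁿ z₋ᵐ`. -/
abbrev V : Type := (ℕ × ℕ) →₀ ℂ

/-- The `p`-integer `[k]_p = (1 − pᵏ)/(1 − p)`. -/
def qint (p : ℂ) (k : ℕ) : ℂ := (1 - p ^ k) / (1 - p)

/-- Right multiplication by `z₊`: `Ẑ₊ e(n,m) = q^{2m} e(n+1,m)`. -/
def Zp (q : ℝ) : V →ₗ[ℂ] V :=
  Finsupp.lsum ℂ fun nm => ((q : ℂ) ^ (2 * nm.2)) • Finsupp.lsingle (nm.1 + 1, nm.2)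

/-- Right multiplication by `z₋`: `Ẑ₋ e(n,m) = e(n,m+1)`. -/
def Zm : V →ₗ[ℂ] V :=
  Finsupp.lsum ℂ fun nm => Finsupp.lsingle (nm.1, nm.2 + 1)

/-- `P₊ e(n,m) = iℏ [n]_{q⁻²} e(n−1,m)` (the `n = 0` term vanishes since `[0] = 0`). -/
def Pp (q ℏ : ℝ) : V →ₗ[ℂ] V :=
  Finsupp.lsum ℂ fun nm =>
    (Complex.I * (ℏ : ℂ) * qint (((q : ℂ) ^ 2)⁻¹) nm.1) • Finsupp.lsingle (nm.1 - 1, nm.2)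

/-- `P₋ e(n,m) = iℏ q^{−2n} [m]_{q²} e(n,m−1)` (the `m = 0` term vanishes since `[0] = 0`). -/
def Pm (q ℏ : ℝ) : V →ₗ[ℂ] V :=
  Finsupp.lsum ℂ fun nm =>
    (Complex.I * (ℏ : ℂ) * ((q : ℂ) ^ (2 * nm.1))⁻¹ * qint ((q : ℂ) ^ 2) nm.2) •
      Finsupp.lsingle (nm.1, nm.2 - 1)

/-- The angular momentum operator `L e(n,m) = ℏ (n − m) e(n,m)`. -/
def Lop (ℏ : ℝ) : V →ₗ[ℂ] V :=
  Finsupp.lsum ℂ fun nm => ((ℏ : ℂ) * ((nm.1 : ℂ) - (nm.2 : ℂ))) • Finsupp.lsingle nm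

/-- The diagonal operator `Q e(n,m) = q^{2(m−n)} e(n,m)`, i.e. `Q = exp((2Λ/ℏ)·L)`. -/
def Qop (q : ℝ) : V →ₗ[ℂ] V :=
  Finsupp.lsum ℂ fun nm =>
    ((q : ℂ) ^ (2 * nm.2) * ((q : ℂ) ^ (2 * nm.1))⁻¹) • Finsupp.lsingle nm

/-- `X̂ = (Ẑ₊ + Ẑ₋)/√2`. -/
def Xop (q : ℝ) : V →ₗ[ℂ] V := ((Real.sqrt 2 : ℂ))⁻¹ • (Zp q + Zm)

/-- `Ŷ = (Ẑ₊ − Ẑ₋)/(√2 i)`. -/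
def Yop (q : ℝ) : V →ₗ[ℂ] V := (((Real.sqrt 2 : ℂ)) * Complex.I)⁻¹ • (Zp q - Zm)

/-- `P_x = (P₊ + P₋)/√2`. -/
def Px (q ℏ : ℝ) : V →ₗ[ℂ] V := ((Real.sqrt 2 : ℂ))⁻¹ • (Pp q ℏ + Pm q ℏ)

/-- `P_y = i (P₊ − P₋)/√2`. -/
def Py (q ℏ : ℝ) : V →ₗ[ℂ] V := (Complex.I / (Real.sqrt 2 : ℂ)) • (Pp q ℏ - Pm q ℏ)


theorem Pp_single (q ℏ : ℝ) (n m : ℕ) (a : ℂ) :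
    Pp q ℏ (Finsupp.single (n, m) a) =
      Finsupp.single (n - 1, m) (Complex.I * (ℏ : ℂ) * qint (((q : ℂ) ^ 2)⁻¹) n * a) := by
  simp [Pp]

theorem Pm_single (q ℏ : ℝ) (n m : ℕ) (a : ℂ) :
    Pm q ℏ (Finsupp.single (n, m) a) =
      Finsupp.single (n, m - 1)
        (Complex.I * (ℏ : ℂ) * ((q : ℂ) ^ (2 * n))⁻¹ * qint ((q : ℂ) ^ 2) m * a) := by
  simp [Pm]

theorem qint_zero (p : ℂ) : qint p 0 = 0 := by
  simp [qint]

/-- The `q`-commutation relation `P₋ P₊ = q² P₊ P₋`. -/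
theorem Pm_comp_Pp (q ℏ : ℝ) (hq : q ≠ 0) :
    Pm q ℏ ∘ₗ Pp q ℏ = ((q : ℂ) ^ 2) • (Pp q ℏ ∘ₗ Pm q ℏ) := by
  have hqc : (q : ℂ) ≠ 0 := by exact_mod_cast hq
  refine Finsupp.lhom_ext fun ⟨n, m⟩ a => ?_
  simp only [LinearMap.comp_apply, LinearMap.smul_apply, Pp_single, Pm_single,
    Finsupp.smul_single, smul_eq_mul]
  congr 1
  cases n with
  | zero => simp [qint_zero]
  | succ k =>
    rw [Nat.add_sub_cancel, mul_add, pow_add]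
    field_simp
    ring

theorem tanh_log_one_div {q : ℝ} (hq : 0 < q) :
    Real.tanh (Real.log (1 / q)) = (1 - q ^ 2) / (1 + q ^ 2) := by
  rw [Real.tanh_eq_sinh_div_cosh, Real.sinh_eq, Real.cosh_eq, Real.exp_neg,
    Real.exp_log (by positivity)]
  field_simp

theorem Px_comp_Py_sub (q ℏ : ℝ) :
    Px q ℏ ∘ₗ Py q ℏ - Py q ℏ ∘ₗ Px q ℏ =
      Complex.I • (Pm q ℏ ∘ₗ Pp q ℏ - Pp q ℏ ∘ₗ Pm q ℏ) := by
  have h2 : ((Real.sqrt 2 : ℝ) : ℂ) ^ 2 = 2 := by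
    rw [← Complex.ofReal_pow, Real.sq_sqrt zero_le_two, Complex.ofReal_ofNat]
  simp only [Px, Py, LinearMap.comp_smul, LinearMap.smul_comp, LinearMap.comp_add,
    LinearMap.add_comp, LinearMap.comp_sub, LinearMap.sub_comp]
  match_scalars <;> field_simp <;> simp only [h2] <;> ring

theorem Px_sq_add_Py_sq (q ℏ : ℝ) :
    Px q ℏ ∘ₗ Px q ℏ + Py q ℏ ∘ₗ Py q ℏ =
      Pm q ℏ ∘ₗ Pp q ℏ + Pp q ℏ ∘ₗ Pm q ℏ := by
  have h2 : ((Real.sqrt 2 : ℝ) : ℂ) ^ 2 = 2 := by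
    rw [← Complex.ofReal_pow, Real.sq_sqrt zero_le_two, Complex.ofReal_ofNat]
  simp only [Px, Py, LinearMap.comp_smul, LinearMap.smul_comp, LinearMap.comp_add,
    LinearMap.add_comp, LinearMap.comp_sub, LinearMap.sub_comp]
  match_scalars <;> field_simp <;> simp only [h2, Complex.I_sq] <;> ring

/-- The Cartesian momentum operators on the quantum-plane monomial module
satisfy `[P_x, P_y] = −i tanh(Λ) (P_x² + P_y²)`, where `Λ = log (1/q)`. -/
theorem cartesian_momentum_commutator (q ℏ : ℝ) (hq0 : 0 < q) (hq1 : q < 1) (hℏ : 0 < ℏ)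
    (Λ : ℝ) (hΛ : Λ = Real.log (1 / q)) :
    Px q ℏ ∘ₗ Py q ℏ - Py q ℏ ∘ₗ Px q ℏ =
      (-(Complex.I) * (Real.tanh Λ : ℂ)) • (Px q ℏ ∘ₗ Px q ℏ + Py q ℏ ∘ₗ Py q ℏ) := by
  have hd : (1 : ℂ) + (q : ℂ) ^ 2 ≠ 0 := by
    exact_mod_cast (by positivity : (1 : ℝ) + q ^ 2 ≠ 0)
  rw [Px_comp_Py_sub, Px_sq_add_Py_sq, Pm_comp_Pp q ℏ hq0.ne', hΛ, tanh_log_one_div hq0]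
  push_cast
  match_scalars
  field_simp
  ring

end
end

section
/- The right-multiplication position operators on the quantum-plane monomial module satisfy Ẑ₊∘Ẑ₋ = q²·(Ẑ₋∘Ẑ₊) and the commutation relation [X̂, Ŷ] = −i·tanh(Λ)·(X̂² + Ŷ²) as linear operators on V. -/
noncomputable section

/-- The `q`-commutation relation of the right multiplications by `z₊` and `z₋`. -/
theorem Zp_comp_Zm (q : ℝ) : Zp q ∘ₗ Zm = ((q : ℂ) ^ 2) • (Zm ∘ₗ Zp q) := by
  apply Finsupp.lhom_ext
  rintro ⟨n, m⟩ c
  simp only [Zp, Zm, LinearMap.comp_apply, LinearMap.smul_apply, Finsupp.lsum_single,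
    Finsupp.lsingle_apply, Finsupp.smul_single, smul_eq_mul]
  congr 1
  ring

/-- The commutator `[X̂, Ŷ]` in terms of `Ẑ₊` and `Ẑ₋`. -/
theorem Xop_Yop_commutator (q : ℝ) :
    Xop q ∘ₗ Yop q - Yop q ∘ₗ Xop q = Complex.I • (Zp q ∘ₗ Zm - Zm ∘ₗ Zp q) := by
  have h : ((Real.sqrt 2 : ℂ))⁻¹ * ((Real.sqrt 2 : ℂ) * Complex.I)⁻¹ = -Complex.I / 2 := by
    rw [mul_inv, Complex.inv_I, ← mul_assoc, ← mul_inv, ← Complex.ofReal_mul,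
      Real.mul_self_sqrt zero_le_two]
    push_cast
    ring
  simp only [Xop, Yop, LinearMap.comp_smul, LinearMap.smul_comp,
    LinearMap.comp_add, LinearMap.add_comp, LinearMap.comp_sub, LinearMap.sub_comp]
  generalize ((Real.sqrt 2 : ℂ))⁻¹ = a at *
  generalize ((Real.sqrt 2 : ℂ) * Complex.I)⁻¹ = b at *
  match_scalars
  · ring
  · linear_combination 2 * h
  · linear_combination -2 * h
  · ring

/-- The squared radius `X̂² + Ŷ²` in terms of `Ẑ₊` and `Ẑ₋`. -/
theorem Xop_sq_add_Yop_sq (q : ℝ) :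
    Xop q ∘ₗ Xop q + Yop q ∘ₗ Yop q = Zp q ∘ₗ Zm + Zm ∘ₗ Zp q := by
  have hX : ((Real.sqrt 2 : ℂ))⁻¹ * ((Real.sqrt 2 : ℂ))⁻¹ = 1 / 2 := by
    rw [← mul_inv, ← Complex.ofReal_mul, Real.mul_self_sqrt zero_le_two]
    norm_num
  have hY : ((Real.sqrt 2 : ℂ) * Complex.I)⁻¹ * ((Real.sqrt 2 : ℂ) * Complex.I)⁻¹ = -1 / 2 := by
    rw [mul_inv, mul_mul_mul_comm, hX, Complex.inv_I, neg_mul_neg, Complex.I_mul_I]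
    norm_num
  simp only [Xop, Yop, LinearMap.comp_smul, LinearMap.smul_comp,
    LinearMap.comp_add, LinearMap.add_comp, LinearMap.comp_sub, LinearMap.sub_comp]
  generalize ((Real.sqrt 2 : ℂ))⁻¹ = a at *
  generalize ((Real.sqrt 2 : ℂ) * Complex.I)⁻¹ = b at *
  match_scalars
  · linear_combination hX + hY
  · linear_combination hX - hY
  · linear_combination hX - hY
  · linear_combination hX + hY

/-- The right-multiplication position operators on the quantum-plane monomial
module satisfy `Ẑ₊ ∘ Ẑ₋ = q² (Ẑ₋ ∘ Ẑ₊)` and `[X̂, Ŷ] = −i tanh(Λ) (X̂² + Ŷ²)`,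
where `Λ = log (1/q)`. -/
theorem position_operator_commutators (q ℏ : ℝ) (hq0 : 0 < q) (hq1 : q < 1) (hℏ : 0 < ℏ)
    (Λ : ℝ) (hΛ : Λ = Real.log (1 / q)) :
    Zp q ∘ₗ Zm = ((q : ℂ) ^ 2) • (Zm ∘ₗ Zp q) ∧
    Xop q ∘ₗ Yop q - Yop q ∘ₗ Xop q =
      (-(Complex.I) * (Real.tanh Λ : ℂ)) • (Xop q ∘ₗ Xop q + Yop q ∘ₗ Yop q) := by
  refine ⟨Zp_comp_Zm q, ?_⟩
  have h : (1 + (q : ℂ) ^ 2) ≠ 0 := by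
    have : (1 + q ^ 2 : ℝ) ≠ 0 := by positivity
    exact_mod_cast this
  rw [Xop_Yop_commutator, Xop_sq_add_Yop_sq, Zp_comp_Zm, hΛ, tanh_log_one_div hq0]
  push_cast
  match_scalars
  field_simp
  ring

end
end
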